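/- arXiv:math/0409281 — 6 statements merged into one kernel-verified Lean document; each statement's English description precedes it below -/
import Mathlib

section
/- Let G and G' be two 2-dimensional subspaces of ℂ⁴ with dim(G ⊓ G') = 1 (two distinct lines of ℙ³ meeting in a point). Set P = G ⊓ G' (a 1-dimensional subspace) and E = G + G' (a 3-dimensional subspace). Then for every 2-dimensional subspace W of ℂ⁴, one has (W ⊓ G ≠ ⊥ and W ⊓ G' ≠ ⊥) if and only if (P ≤ W or W ≤ E). (Geometric content of Schubert's formula 9): g² = g_p + g_e: a line meets two given coplanar lines iff it passes through their intersection point or lies in their common plane.) -/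
open Module

/-- Two subspaces of a subspace `E` whose dimensions add up to more than `dim E` meet
nontrivially. -/
theorem Submodule.inf_ne_bot_of_finrank_lt_add {K V : Type*} [DivisionRing K] [AddCommGroup V]
    [Module K V] [FiniteDimensional K V] {A B E : Submodule K V} (hA : A ≤ E) (hB : B ≤ E)
    (h : finrank K E < finrank K A + finrank K B) : A ⊓ B ≠ ⊥ := by
  intro hbot
  have hsum := Submodule.finrank_sup_add_finrank_inf_eq A B
  have hle := Submodule.finrank_mono (sup_le hA hB)
  rw [hbot, finrank_bot] at hsum
  omega

/-- A plane `W` containing two nonzero subspaces with trivial intersection is their sum. -/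
theorem Submodule.sup_eq_of_finrank_eq_two {K V : Type*} [DivisionRing K] [AddCommGroup V]
    [Module K V] [FiniteDimensional K V] {A B W : Submodule K V} (hW : finrank K W = 2)
    (hAW : A ≤ W) (hBW : B ≤ W) (hA : A ≠ ⊥) (hB : B ≠ ⊥) (hAB : A ⊓ B = ⊥) : A ⊔ B = W := by
  refine Submodule.eq_of_le_of_finrank_le (sup_le hAW hBW) ?_
  have hsum := Submodule.finrank_sup_add_finrank_inf_eq A B
  have hA1 := Submodule.one_le_finrank_iff.mpr hA
  have hB1 := Submodule.one_le_finrank_iff.mpr hB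
  rw [hAB, finrank_bot] at hsum
  omega

/-- Schubert's formula 9), `g² = g_p + g_e`: a line `W` meets two given coplanar
lines `G`, `G'` (meeting in a point) iff it passes through their intersection
point `P = G ⊓ G'` or lies in their common plane `E = G ⊔ G'`. -/
theorem schubert_g_squared (G G' : Submodule ℂ (Fin 4 → ℂ))
    (hG : finrank ℂ G = 2) (hG' : finrank ℂ G' = 2)
    (hGG' : finrank ℂ ↥(G ⊓ G') = 1) :
    ∀ W : Submodule ℂ (Fin 4 → ℂ), finrank ℂ W = 2 →
      ((W ⊓ G ≠ ⊥ ∧ W ⊓ G' ≠ ⊥) ↔ (G ⊓ G' ≤ W ∨ W ≤ G ⊔ G')) := by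
  intro W hW
  have hsum := Submodule.finrank_sup_add_finrank_inf_eq G G'
  have hP : IsAtom (G ⊓ G') := Submodule.isAtom_iff_finrank_eq_one.mpr hGG'
  constructor
  · rintro ⟨h, h'⟩
    refine or_iff_not_imp_left.mpr fun hPW => ?_
    have hbot : (W ⊓ G) ⊓ (W ⊓ G') = ⊥ := by
      rw [← inf_inf_distrib_left, inf_comm]
      exact hP.not_le_iff_disjoint.mp hPW |>.eq_bot
    rw [← Submodule.sup_eq_of_finrank_eq_two hW inf_le_left inf_le_left h h' hbot]
    exact sup_le_sup inf_le_right inf_le_right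
  · rintro (hPW | hWE)
    · exact ⟨ne_bot_of_le_ne_bot hP.1 (le_inf hPW inf_le_left),
        ne_bot_of_le_ne_bot hP.1 (le_inf hPW inf_le_right)⟩
    · exact ⟨Submodule.inf_ne_bot_of_finrank_lt_add hWE le_sup_left (by omega),
        Submodule.inf_ne_bot_of_finrank_lt_add hWE le_sup_right (by omega)⟩
end

section
/- Let P be a 1-dimensional and G a 2-dimensional subspace of ℂ⁴ with P ⊓ G = ⊥ (a point of ℙ³ not on the line G). Then for every 2-dimensional subspace W of ℂ⁴, one has (P ≤ W and W ⊓ G ≠ ⊥) if and only if (P ≤ W and W ≤ P + G). (Geometric content of Schubert's formula 10): g·g_p = g_s: the lines through a given point meeting a given line not containing it form the pencil with vertex that point inside the plane spanned by the point and the line.) -/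
open Module

/-- Schubert's formula 10), `g·g_p = g_s`: the lines `W` through a given point `P`
meeting a given line `G` not containing it form the pencil with vertex `P` inside
the plane `P ⊔ G`. -/
theorem schubert_g_gp (P G : Submodule ℂ (Fin 4 → ℂ))
    (hP : finrank ℂ P = 1) (hG : finrank ℂ G = 2)
    (hPG : P ⊓ G = ⊥) :
    ∀ W : Submodule ℂ (Fin 4 → ℂ), finrank ℂ W = 2 →
      ((P ≤ W ∧ W ⊓ G ≠ ⊥) ↔ (P ≤ W ∧ W ≤ P ⊔ G)) := by
  intro W hW
  refine and_congr_right fun hPW => ⟨fun hne => ?_, fun hle hbot => ?_⟩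
  · have hdisj : P ⊓ (W ⊓ G) = ⊥ := by
      rw [inf_left_comm, hPG, inf_bot_eq]
    have hdim := Submodule.finrank_sup_add_finrank_inf_eq P (W ⊓ G)
    rw [hdisj, finrank_bot, hP] at hdim
    have hpos : 1 ≤ finrank ℂ ↥(W ⊓ G) := Submodule.one_le_finrank_iff.mpr hne
    have heq : P ⊔ W ⊓ G = W :=
      Submodule.eq_of_le_of_finrank_le (sup_le hPW inf_le_left) (by omega)
    exact heq.symm.le.trans (sup_le_sup_left inf_le_right P)
  · have hmod : P ⊔ G ⊓ W = (P ⊔ G) ⊓ W := (sup_inf_assoc_of_le G hPW).symm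
    rw [inf_comm G W, hbot, sup_bot_eq, inf_eq_right.mpr hle] at hmod
    rw [← hmod, hP] at hW
    omega
end

section
/- Let E be a 3-dimensional and G a 2-dimensional subspace of ℂ⁴ with G ≰ E (a line of ℙ³ not contained in the plane E). Then G ⊓ E is 1-dimensional, and for every 2-dimensional subspace W of ℂ⁴ one has (W ≤ E and W ⊓ G ≠ ⊥) if and only if (G ⊓ E ≤ W and W ≤ E). (Geometric content of Schubert's formula g·g_e = g_s: the lines in a given plane meeting a given line not contained in it form the pencil of lines in that plane through the intersection point.) -/
open Module

/-- Schubert's formula `g·g_e = g_s`: the lines `W` in a given plane `E` meeting a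
given line `G` not contained in `E` form the pencil of lines of `E` through the
intersection point `G ⊓ E`. -/
theorem schubert_g_ge (E G : Submodule ℂ (Fin 4 → ℂ))
    (hE : finrank ℂ E = 3) (hG : finrank ℂ G = 2)
    (hGE : ¬ G ≤ E) :
    finrank ℂ ↥(G ⊓ E) = 1 ∧
    ∀ W : Submodule ℂ (Fin 4 → ℂ), finrank ℂ W = 2 →
      ((W ≤ E ∧ W ⊓ G ≠ ⊥) ↔ (G ⊓ E ≤ W ∧ W ≤ E)) := by
  have h_point : finrank ℂ ↥(G ⊓ E) = 1 := by
    have h_sum := Submodule.finrank_sup_add_finrank_inf_eq G E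
    have h_sup : finrank ℂ ↥(G ⊔ E) ≤ 4 := by
      simpa using Submodule.finrank_le (G ⊔ E)
    have h_lt : finrank ℂ ↥(G ⊓ E) < finrank ℂ G :=
      Submodule.finrank_lt_finrank_of_lt (inf_lt_left.mpr hGE)
    omega
  refine ⟨h_point, fun W _ => ⟨fun ⟨hWE, hWG⟩ => ⟨?_, hWE⟩, fun ⟨hW, hWE⟩ => ⟨hWE, ?_⟩⟩⟩
  · have h_le : W ⊓ G ≤ G ⊓ E := le_inf inf_le_right (inf_le_left.trans hWE)
    have h_pos : 1 ≤ finrank ℂ ↥(W ⊓ G) := Submodule.one_le_finrank_iff.mpr hWG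
    have h_eq : W ⊓ G = G ⊓ E :=
      Submodule.eq_of_le_of_finrank_le h_le (h_point.trans_le h_pos)
    exact h_eq ▸ inf_le_left
  · exact ne_bot_of_le_ne_bot (Submodule.one_le_finrank_iff.mp h_point.ge)
      (le_inf hW inf_le_left)
end

section
/- Let G ≤ E be subspaces of ℂ⁴ with dim G = 2 and dim E = 3 (a line of ℙ³ contained in a plane E). Then for every 1-dimensional subspace L and every 2-dimensional subspace W of ℂ⁴ with L ≤ W (a point lying on a line of ℙ³), one has (W ⊓ G ≠ ⊥ and L ≤ E) if and only if (L ≤ G or W ≤ E). (Geometric content of Schubert's fundamental formula I) for the space of points on lines: pg = p_g + g_e.) -/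
open Module

/-- Schubert's fundamental formula I) for the space of points on lines:
`pg = p_g + g_e`, for a flag consisting of a line `G` inside a plane `E`. -/
theorem schubert_formula_I (G E : Submodule ℂ (Fin 4 → ℂ))
    (hGE : G ≤ E) (hG : finrank ℂ G = 2) (hE : finrank ℂ E = 3) :
    ∀ L W : Submodule ℂ (Fin 4 → ℂ), finrank ℂ L = 1 → finrank ℂ W = 2 → L ≤ W →
      ((W ⊓ G ≠ ⊥ ∧ L ≤ E) ↔ (L ≤ G ∨ W ≤ E)) := by
  intro L W hL hW hLW
  constructor
  · rintro ⟨hWG, hLE⟩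
    refine or_iff_not_imp_left.2 fun hLG => ?_
    -- `L` and `W ⊓ G` are independent, so together they span `W`.
    have h_inf : finrank ℂ ↥(L ⊓ (W ⊓ G)) < finrank ℂ L :=
      Submodule.finrank_lt_finrank_of_lt <|
        inf_le_left.lt_of_ne fun h => hLG <| (inf_eq_left.1 h).trans inf_le_right
    have h_pos : 1 ≤ finrank ℂ ↥(W ⊓ G) := Submodule.one_le_finrank_iff.2 hWG
    have h_dim := Submodule.finrank_sup_add_finrank_inf_eq L (W ⊓ G)
    have h_sup : L ⊔ W ⊓ G = W :=
      Submodule.eq_of_le_of_finrank_le (sup_le hLW inf_le_left) (by omega)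
    exact h_sup ▸ sup_le hLE (inf_le_right.trans hGE)
  · rintro (hLG | hWE)
    · refine ⟨fun h => ?_, hLG.trans hGE⟩
      have hL_bot : L = ⊥ := le_bot_iff.1 (h ▸ le_inf hLW hLG)
      rw [hL_bot, finrank_bot] at hL
      omega
    · refine ⟨Submodule.one_le_finrank_iff.1 ?_, hLW.trans hWE⟩
      have h_dim := Submodule.finrank_sup_add_finrank_inf_eq W G
      have h_le := Submodule.finrank_mono (sup_le hWE hGE)
      omega
end

section
/- Let v₁, v₂, v₃, v₄ be a basis of ℂ⁴ (four points P, Q, R, S of ℙ³ in general position). Then the set of 2-dimensional subspaces W of ℂ⁴ satisfying W ⊓ span(v₁,v₂) ≠ ⊥, W ⊓ span(v₂,v₃) ≠ ⊥, W ⊓ span(v₃,v₄) ≠ ⊥ and W ⊓ span(v₄,v₁) ≠ ⊥ is exactly {span(v₁,v₃), span(v₂,v₄)}. (There are exactly two lines in ℙ³ meeting the four lines PQ, QR, RS, SP; Schubert's enumerative result g⁴ = 2G in this degenerate configuration.) -/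
open Module

section

variable {K V ι : Type*} [Field K] [AddCommGroup V] [Module K V]

/-- Three nonzero vectors in echelon form with respect to linear functionals `φ`, `ψ` do not fit
in a plane. -/
lemma Submodule.mul_eq_zero_of_finrank_eq_two {W : Submodule K V} (hW : finrank K W = 2)
    (φ ψ : V →ₗ[K] K) {e f g : V} (he : e ∈ W) (hf : f ∈ W) (hg : g ∈ W) (hg0 : g ≠ 0)
    (hφf : φ f = 0) (hφg : φ g = 0) (hψg : ψ g = 0) : φ e * ψ f = 0 := by
  by_contra h
  obtain ⟨h₁, h₂⟩ := mul_ne_zero_iff.mp h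
  have : FiniteDimensional K W := FiniteDimensional.of_finrank_pos (by omega)
  have hli : LinearIndependent K ![(⟨e, he⟩ : W), ⟨f, hf⟩, ⟨g, hg⟩] := by
    rw [Fintype.linearIndependent_iff]
    intro c hc
    replace hc : c 0 • e + c 1 • f + c 2 • g = 0 := by
      simpa [Fin.sum_univ_three] using congrArg Subtype.val hc
    have hc₀ : c 0 = 0 := by simpa [hφf, hφg, h₁] using congrArg φ hc
    have hc₁ : c 1 = 0 := by simpa [hc₀, hψg, h₂] using congrArg ψ hc
    have hc₂ : c 2 = 0 := by simpa [hc₀, hc₁, hg0] using hc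
    intro i
    fin_cases i <;> assumption
  have := hli.fintype_card_le_finrank
  simp [hW] at this

/-- The span of two distinct basis vectors is a plane. -/
lemma Module.Basis.finrank_span_pair (v : Basis ι K V) {i j : ι} (hij : i ≠ j) :
    finrank K (Submodule.span K {v i, v j}) = 2 := by
  have h := finrank_span_eq_card (v.linearIndependent.comp ![i, j] (by
    intro a b; fin_cases a <;> fin_cases b <;> simp [hij, hij.symm]))
  rw [Set.range_comp, Matrix.range_cons_cons_empty, Set.image_pair] at h
  simpa using h

/-- A plane containing two distinct basis vectors is their span. -/
lemma Module.Basis.eq_span_pair (v : Basis ι K V) {i j : ι} (hij : i ≠ j) {W : Submodule K V}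
    (hW : finrank K W = 2) (hi : v i ∈ W) (hj : v j ∈ W) :
    W = Submodule.span K {v i, v j} := by
  have : FiniteDimensional K W := FiniteDimensional.of_finrank_pos (by omega)
  refine (Submodule.eq_of_le_of_finrank_eq ?_ (by rw [hW, v.finrank_span_pair hij])).symm
  simp [Submodule.span_le, Set.pair_subset_iff, hi, hj]

/-- Subspaces sharing a basis vector meet. -/
lemma Module.Basis.inf_ne_bot (v : Basis ι K V) (i : ι) {U W : Submodule K V}
    (hU : v i ∈ U) (hW : v i ∈ W) : U ⊓ W ≠ ⊥ :=
  (Submodule.ne_bot_iff _).mpr ⟨v i, ⟨hU, hW⟩, v.ne_zero i⟩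

/-- A subspace meeting the span of two vectors contains a nonzero combination of them. -/
lemma Submodule.exists_smul_add_smul_mem {W : Submodule K V} {x y : V}
    (h : W ⊓ Submodule.span K {x, y} ≠ ⊥) :
    ∃ a b : K, a • x + b • y ∈ W ∧ a • x + b • y ≠ 0 := by
  obtain ⟨z, ⟨hzW, hz⟩, hz0⟩ := (Submodule.ne_bot_iff _).mp h
  obtain ⟨a, b, rfl⟩ := Submodule.mem_span_pair.mp hz
  exact ⟨a, b, hzW, hz0⟩

end

/-- Schubert's enumerative result `g⁴ = 2G` in the degenerate configuration: given
four points `v₁, v₂, v₃, v₄` of `ℙ³` in general position (a basis of `ℂ⁴`), exactly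
two lines meet the four lines `v₁v₂`, `v₂v₃`, `v₃v₄`, `v₄v₁`, namely `v₁v₃` and
`v₂v₄`. -/
theorem two_lines_meet_four_lines (v : Basis (Fin 4) ℂ (Fin 4 → ℂ)) :
    {W : Submodule ℂ (Fin 4 → ℂ) | finrank ℂ W = 2 ∧
        W ⊓ Submodule.span ℂ {v 0, v 1} ≠ ⊥ ∧
        W ⊓ Submodule.span ℂ {v 1, v 2} ≠ ⊥ ∧
        W ⊓ Submodule.span ℂ {v 2, v 3} ≠ ⊥ ∧
        W ⊓ Submodule.span ℂ {v 3, v 0} ≠ ⊥} =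
      {Submodule.span ℂ {v 0, v 2}, Submodule.span ℂ {v 1, v 3}} := by
  ext W
  simp only [Set.mem_ofPred_eq, Set.mem_insert_iff, Set.mem_singleton_iff]
  constructor
  · rintro ⟨hW, h01, h12, h23, h30⟩
    obtain ⟨a₀, a₁, ha, ha0⟩ := Submodule.exists_smul_add_smul_mem h01
    obtain ⟨b₁, b₂, hb, hb0⟩ := Submodule.exists_smul_add_smul_mem h12
    obtain ⟨c₂, c₃, hc, hc0⟩ := Submodule.exists_smul_add_smul_mem h23
    obtain ⟨d₃, d₀, hd, hd0⟩ := Submodule.exists_smul_add_smul_mem h30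
    have hab : a₀ * b₁ = 0 := by
      simpa using Submodule.mul_eq_zero_of_finrank_eq_two hW (v.coord 0) (v.coord 1)
        ha hb hc hc0 (by simp) (by simp) (by simp)
    have hda : d₃ * a₀ = 0 := by
      simpa using Submodule.mul_eq_zero_of_finrank_eq_two hW (v.coord 3) (v.coord 0)
        hd ha hb hb0 (by simp) (by simp) (by simp)
    have hba : b₂ * a₁ = 0 := by
      simpa using Submodule.mul_eq_zero_of_finrank_eq_two hW (v.coord 2) (v.coord 1)
        hb ha hd hd0 (by simp) (by simp) (by simp)
    have had : a₁ * d₀ = 0 := by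
      simpa using Submodule.mul_eq_zero_of_finrank_eq_two hW (v.coord 1) (v.coord 0)
        ha hd hc hc0 (by simp) (by simp) (by simp)
    by_cases h : a₀ = 0
    · have h₁ : a₁ ≠ 0 := by rintro rfl; simp [h] at ha0
      obtain rfl : b₂ = 0 := by simpa [h₁] using hba
      obtain rfl : d₀ = 0 := by simpa [h₁] using had
      have hb₁ : b₁ ≠ 0 := by rintro rfl; simp at hb0
      have hd₃ : d₃ ≠ 0 := by rintro rfl; simp at hd0
      right
      refine v.eq_span_pair (by decide) hW ?_ ?_
      · simpa [W.smul_mem_iff hb₁] using hb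
      · simpa [W.smul_mem_iff hd₃] using hd
    · obtain rfl : b₁ = 0 := by simpa [h] using hab
      obtain rfl : d₃ = 0 := by simpa [h] using hda
      have hb₂ : b₂ ≠ 0 := by rintro rfl; simp at hb0
      have hd₀ : d₀ ≠ 0 := by rintro rfl; simp at hd0
      left
      refine v.eq_span_pair (by decide) hW ?_ ?_
      · simpa [W.smul_mem_iff hd₀] using hd
      · simpa [W.smul_mem_iff hb₂] using hb
  · have hl (i j : Fin 4) : v i ∈ Submodule.span ℂ {v i, v j} := Submodule.subset_span (by simp)
    have hr (i j : Fin 4) : v j ∈ Submodule.span ℂ {v i, v j} := Submodule.subset_span (by simp)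
    rintro (rfl | rfl)
    · exact ⟨v.finrank_span_pair (by decide), v.inf_ne_bot 0 (hl _ _) (hl _ _),
        v.inf_ne_bot 2 (hr _ _) (hr _ _), v.inf_ne_bot 2 (hr _ _) (hl _ _),
        v.inf_ne_bot 0 (hl _ _) (hr _ _)⟩
    · exact ⟨v.finrank_span_pair (by decide), v.inf_ne_bot 1 (hl _ _) (hr _ _),
        v.inf_ne_bot 1 (hl _ _) (hl _ _), v.inf_ne_bot 3 (hr _ _) (hr _ _),
        v.inf_ne_bot 3 (hr _ _) (hl _ _)⟩
end

section
/- Let α₀, α' be ℂ-vector spaces with dim α₀ = dim α' = 2, let ℓ₁ ≠ ℓ₂ be distinct 1-dimensional subspaces of α₀, and let m₁, m₂ be 1-dimensional subspaces of α'. Then the subspace {Ā ∈ Hom(α₀, α') : Ā(ℓ₁) ≤ m₁ and Ā(ℓ₂) ≤ m₂} has dimension 2 = dim Hom(α₀, α') − 2. (Transversality of the two Schubert cycles at a common line meeting the two given lines in distinct points, second case of Proposition 1.) -/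
open Module

/-- The subspace of `Hom(V, W)` of maps sending the subspace `ℓ ≤ V` into the
subspace `m ≤ W`. For `m = Im(A - B)` and `ℓ = ker(A - B)`, this is the tangent
space at `ℓ_A` to the Schubert cycle of lines meeting `ℓ_B`. -/
def mapCond {K V W : Type*} [Field K] [AddCommGroup V] [Module K V]
    [AddCommGroup W] [Module K W] (ℓ : Submodule K V) (m : Submodule K W) :
    Submodule K (V →ₗ[K] W) where
  carrier := {A | ∀ x ∈ ℓ, A x ∈ m}
  add_mem' := by
    intro a b ha hb x hx
    simpa using m.add_mem (ha x hx) (hb x hx)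
  zero_mem' := by intro x hx; simp
  smul_mem' := by
    intro c a ha x hx
    simpa using m.smul_mem c (ha x hx)

/-- When `ℓ₁` and `ℓ₂` are complementary, a map sending `ℓ₁` into `m₁` and `ℓ₂` into `m₂` is
the same as a pair of maps `ℓ₁ → m₁` and `ℓ₂ → m₂`. -/
noncomputable def mapCondInfEquiv {K V W : Type*} [Field K] [AddCommGroup V] [Module K V]
    [AddCommGroup W] [Module K W] {ℓ₁ ℓ₂ : Submodule K V} (h : IsCompl ℓ₁ ℓ₂)
    (m₁ m₂ : Submodule K W) :
    ↥(mapCond ℓ₁ m₁ ⊓ mapCond ℓ₂ m₂) ≃ₗ[K] (ℓ₁ →ₗ[K] m₁) × (ℓ₂ →ₗ[K] m₂) where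
  toFun A := (A.1.restrict A.2.1, A.1.restrict A.2.2)
  map_add' _ _ := rfl
  map_smul' _ _ := rfl
  invFun φ := ⟨LinearMap.ofIsCompl h (m₁.subtype ∘ₗ φ.1) (m₂.subtype ∘ₗ φ.2),
    fun x hx => by
      rw [LinearMap.ofIsCompl_apply_left h ⟨x, hx⟩]
      exact (φ.1 ⟨x, hx⟩).2,
    fun x hx => by
      rw [LinearMap.ofIsCompl_apply_right h ⟨x, hx⟩]
      exact (φ.2 ⟨x, hx⟩).2⟩
  left_inv _ := Subtype.ext (LinearMap.ofIsCompl_eq h (fun _ => rfl) fun _ => rfl)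
  right_inv φ := by
    ext x
    · exact LinearMap.ofIsCompl_apply_left h x
    · exact LinearMap.ofIsCompl_apply_right h x

/-- Distinct lines of a plane are complementary. -/
theorem isCompl_of_finrank_eq_one_of_ne {K V : Type*} [Field K] [AddCommGroup V] [Module K V]
    [FiniteDimensional K V] (hV : finrank K V = 2) {ℓ₁ ℓ₂ : Submodule K V}
    (h₁ : finrank K ℓ₁ = 1) (h₂ : finrank K ℓ₂ = 1) (h : ℓ₁ ≠ ℓ₂) : IsCompl ℓ₁ ℓ₂ := by
  have hd : Disjoint ℓ₁ ℓ₂ :=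
    (Submodule.isAtom_iff_finrank_eq_one.mpr h₁).disjoint_of_ne
      (Submodule.isAtom_iff_finrank_eq_one.mpr h₂) h
  exact (Submodule.isCompl_iff_disjoint ℓ₁ ℓ₂ (by lia)).mpr hd

/-- Transversality of the two Schubert cycles at a common line meeting the two
given lines in distinct points (second case of Proposition 1): for distinct lines
`ℓ₁ ≠ ℓ₂` of `α₀` and lines `m₁`, `m₂` of `α'`, the maps sending `ℓ₁` into `m₁`
and `ℓ₂` into `m₂` form a subspace of dimension `2 = dim Hom(α₀,α') - 2`: the two
codimension-one conditions are independent. -/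
theorem transversality_second_case (α₀ α' : Type*) [AddCommGroup α₀] [Module ℂ α₀]
    [AddCommGroup α'] [Module ℂ α'] [FiniteDimensional ℂ α₀] [FiniteDimensional ℂ α']
    (hα₀ : finrank ℂ α₀ = 2) (hα' : finrank ℂ α' = 2)
    (ℓ₁ ℓ₂ : Submodule ℂ α₀) (hℓ₁ : finrank ℂ ℓ₁ = 1) (hℓ₂ : finrank ℂ ℓ₂ = 1)
    (hℓ : ℓ₁ ≠ ℓ₂)
    (m₁ m₂ : Submodule ℂ α') (hm₁ : finrank ℂ m₁ = 1) (hm₂ : finrank ℂ m₂ = 1) :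
    finrank ℂ ↥(mapCond ℓ₁ m₁ ⊓ mapCond ℓ₂ m₂) = 2 ∧
    finrank ℂ (α₀ →ₗ[ℂ] α') - 2 = 2 := by
  have h := isCompl_of_finrank_eq_one_of_ne hα₀ hℓ₁ hℓ₂ hℓ
  constructor
  · rw [(mapCondInfEquiv h m₁ m₂).finrank_eq, finrank_prod, finrank_linearMap, finrank_linearMap,
      hℓ₁, hℓ₂, hm₁, hm₂]
  · rw [finrank_linearMap, hα₀, hα']
end
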